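/- There exist constants C < ∞ and β > 0 (depending only on w) such that for all m ≥ 0, the total-variation distance between the m-step distribution started at 0 and the stationary distribution satisfies ∑_{y∈ℤ} |Pᵐ(0,y) − ρ(y)| < C·e^{−β m}. -/

import Mathlib

open MeasureTheory Filter
open scoped BigOperators ENNReal

noncomputable section

/-- `p(x) = w(-x)/(w(x)+w(-x))`. -/
def pfun (w : ℤ → ℝ) (x : ℤ) : ℝ := w (-x) / (w x + w (-x))

/-- `q(x) = w(x)/(w(x)+w(-x))`. -/
def qfun (w : ℤ → ℝ) (x : ℤ) : ℝ := w x / (w x + w (-x))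

/-- The Markov transition kernel `P(x,y)`. -/
def Pker (w : ℤ → ℝ) (x y : ℤ) : ℝ :=
  if x - 1 ≤ y then (∏ z ∈ Finset.Icc x y, pfun w z) * qfun w (y + 1) else 0

/-- The `m`-step transition kernel. -/
def Pm (w : ℤ → ℝ) : ℕ → ℤ → ℤ → ℝ
  | 0, x, y => if x = y then 1 else 0
  | m + 1, x, y => ∑' z : ℤ, Pm w m x z * Pker w z y

/-- The normalizing constant `Z`. -/
def Zconst (w : ℤ → ℝ) : ℝ :=
  2 * ∑' x : ℕ, ∏ z ∈ Finset.Icc (1 : ℤ) (x : ℤ), w (-z) / w z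

/-- The stationary distribution `ρ`. -/
def rho (w : ℤ → ℝ) (x : ℤ) : ℝ :=
  (Zconst w)⁻¹ * ∏ z ∈ Finset.Icc (1 : ℤ) (|2 * x + 1| / 2), w (-z) / w z

/-- The weight function `w` is positive, nondecreasing and satisfies
`lim_{z→∞} (w(z) - w(-z)) > 0`. -/
def GoodWeight (w : ℤ → ℝ) : Prop :=
  (∀ z, 0 < w z) ∧ (∀ z, w z ≤ w (z + 1)) ∧
    ∃ c > (0 : ℝ), ∀ᶠ z : ℤ in atTop, c ≤ w z - w (-z)

/-- `η` is a Markov chain with (sub)stochastic kernel `K` started at `a`,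
characterized through its cylinder probabilities. -/
def KChain {Ω : Type*} [MeasurableSpace Ω] (μ : Measure Ω)
    (K : ℤ → ℤ → ℝ) (η : ℕ → Ω → ℤ) (a : ℤ) : Prop :=
  (∀ n, Measurable (η n)) ∧
  ∀ (n : ℕ) (x : ℕ → ℤ),
    μ {ω | ∀ i ≤ n, η i ω = x i} =
      ENNReal.ofReal ((if x 0 = a then (1 : ℝ) else 0) *
        ∏ i ∈ Finset.range n, K (x i) (x (i + 1)))

/-- The unnormalized stationary weight. -/
def statWeight (w : ℤ → ℝ) (x : ℤ) : ℝ :=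
  ∏ z ∈ Finset.Icc (1 : ℤ) (|2 * x + 1| / 2), w (-z) / w z

/-- A function that is odd about `-1/2` and grows like `t ^ |x|`. -/
def oddPow (t : ℝ) (x : ℤ) : ℝ := t ^ x - t ^ (-1 - x)

/-- The action of the transition kernel on functions. -/
def transOp (w : ℤ → ℝ) (φ : ℤ → ℝ) (x : ℤ) : ℝ := ∑' y : ℤ, Pker w x y * φ y

lemma GoodWeight.mono {w : ℤ → ℝ} (hw : GoodWeight w) : Monotone w :=
  monotone_int_of_le_succ hw.2.1

lemma pfun_nonneg {w : ℤ → ℝ} (hw : GoodWeight w) (x : ℤ) : 0 ≤ pfun w x :=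
  div_nonneg (hw.1 _).le (add_pos (hw.1 _) (hw.1 _)).le

lemma qfun_nonneg {w : ℤ → ℝ} (hw : GoodWeight w) (x : ℤ) : 0 ≤ qfun w x :=
  div_nonneg (hw.1 _).le (add_pos (hw.1 _) (hw.1 _)).le

lemma pfun_add_qfun {w : ℤ → ℝ} (hw : GoodWeight w) (x : ℤ) : pfun w x + qfun w x = 1 := by
  have h1 := hw.1 x
  have h2 := hw.1 (-x)
  unfold pfun qfun
  field_simp
  ring

lemma pfun_le_half {w : ℤ → ℝ} (hw : GoodWeight w) {x : ℤ} (hx : 0 ≤ x) :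
    pfun w x ≤ 1 / 2 := by
  have h1 := hw.1 x
  have h2 := hw.1 (-x)
  have h3 : w (-x) ≤ w x := hw.mono (by omega)
  unfold pfun
  rw [div_le_div_iff₀ (by positivity) (by norm_num)]
  linarith

lemma statWeight_pos {w : ℤ → ℝ} (hw : GoodWeight w) (x : ℤ) : 0 < statWeight w x :=
  Finset.prod_pos fun _ _ => div_pos (hw.1 _) (hw.1 _)

lemma statWeight_natCast (w : ℤ → ℝ) (n : ℕ) :
    statWeight w n = ∏ z ∈ Finset.Icc (1 : ℤ) n, w (-z) / w z := by
  have h : |2 * (n : ℤ) + 1| / 2 = n := by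
    rw [abs_of_nonneg (by omega)]
    omega
  rw [statWeight, h]

lemma statWeight_reflect (w : ℤ → ℝ) (x : ℤ) : statWeight w (-1 - x) = statWeight w x := by
  have h : |2 * (-1 - x) + 1| = |2 * x + 1| := by
    rw [← abs_neg]
    congr 1
    ring
  rw [statWeight, statWeight, h]

lemma statWeight_natCast_succ {w : ℤ → ℝ} (n : ℕ) :
    statWeight w (n + 1 : ℕ) = statWeight w n * (w (-(n + 1 : ℕ)) / w (n + 1 : ℕ)) := by
  have h : Finset.Icc (1 : ℤ) (n + 1 : ℕ) = insert ((n + 1 : ℕ) : ℤ) (Finset.Icc (1 : ℤ) n) := by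
    ext z
    simp only [Finset.mem_Icc, Finset.mem_insert]
    omega
  rw [statWeight_natCast, statWeight_natCast, h, Finset.prod_insert (by simp), mul_comm]

lemma statWeight_balance {w : ℤ → ℝ} (hw : GoodWeight w) (x : ℤ) :
    statWeight w (x - 1) * w (-x) = statWeight w x * w x := by
  have key (n : ℕ) : statWeight w n * w (-(n + 1 : ℕ))
      = statWeight w (n + 1 : ℕ) * w (n + 1 : ℕ) := by
    have := (hw.1 (n + 1 : ℕ)).ne'
    rw [statWeight_natCast_succ]
    field_simp
  rcases lt_trichotomy x 0 with h | rfl | h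
  · obtain ⟨n, rfl⟩ : ∃ n : ℕ, x = -((n + 1 : ℕ) : ℤ) := ⟨(-x - 1).toNat, by omega⟩
    have h1 := statWeight_reflect w (n + 1 : ℕ)
    have h2 := statWeight_reflect w n
    rw [show (-((n + 1 : ℕ) : ℤ) - 1) = -1 - (n + 1 : ℕ) by ring, h1,
      show statWeight w (-((n + 1 : ℕ) : ℤ)) = statWeight w n by
        rw [← h2]; congr 1; push_cast; ring, neg_neg]
    exact (key n).symm
  · have := statWeight_reflect w 0
    simp only [sub_zero] at this
    simp [this]
  · obtain ⟨n, rfl⟩ : ∃ n : ℕ, x = ((n + 1 : ℕ) : ℤ) := ⟨(x - 1).toNat, by omega⟩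
    rw [show (((n + 1 : ℕ) : ℤ) - 1) = n by push_cast; ring]
    exact key n

lemma statWeight_flux {w : ℤ → ℝ} (hw : GoodWeight w) (x : ℤ) :
    statWeight w (x - 1) * pfun w x = statWeight w x * qfun w x := by
  unfold pfun qfun
  rw [← mul_div_assoc, ← mul_div_assoc, statWeight_balance hw]

lemma statWeight_antitone {w : ℤ → ℝ} (hw : GoodWeight w) {x : ℤ} (hx : 0 ≤ x) :
    statWeight w x ≤ statWeight w (x - 1) := by
  have h := statWeight_balance hw x
  have h3 : w (-x) ≤ w x := hw.mono (by omega)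
  have h4 := statWeight_pos hw (x - 1)
  have h5 := hw.1 x
  by_contra! h6
  nlinarith

lemma statWeight_decay {w : ℤ → ℝ} (hw : GoodWeight w) :
    ∃ r K : ℝ, 0 < r ∧ r < 1 ∧ 0 < K ∧ ∀ k j : ℕ,
      statWeight w (k + j : ℕ) ≤ K * r ^ j * statWeight w k := by
  obtain ⟨c, hc, hev⟩ := hw.2.2
  obtain ⟨N, hN1, hN2⟩ := ((tendsto_natCast_atTop_atTop (R := ℤ)).eventually hev).and
    (eventually_ge_atTop 0) |>.exists
  have hpN := hw.1 N
  have hmN := hw.1 (-N)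
  set r := w (-N) / w N with hr
  have hr0 : 0 < r := div_pos hmN hpN
  have hr1 : r < 1 := by
    rw [hr, div_lt_one hpN]
    linarith
  have step (k j : ℕ) : statWeight w (k + j : ℕ) ≤ statWeight w k * r ^ (j - N) := by
    induction j with
    | zero => simp
    | succ j ih =>
      have hpos := statWeight_pos hw (k + j : ℕ)
      have h1 := hw.1 ((k + j : ℕ) + 1 : ℕ)
      rw [← add_assoc, statWeight_natCast_succ]
      by_cases hj : j + 1 ≤ N
      · rw [Nat.sub_eq_zero_of_le (by omega)] at ih ⊢
        refine le_trans (mul_le_of_le_one_right hpos.le ?_) ih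
        rw [div_le_one h1]
        exact hw.mono (by omega)
      · rw [show j + 1 - N = (j - N) + 1 by omega, pow_succ, ← mul_assoc]
        refine mul_le_mul ih ?_ (div_nonneg (hw.1 _).le h1.le)
          (mul_nonneg (statWeight_pos hw _).le (by positivity))
        exact div_le_div₀ hmN.le (hw.mono (by omega)) hpN (hw.mono (by omega))
  refine ⟨r, (r ^ N)⁻¹, hr0, hr1, by positivity, fun k j => (step k j).trans ?_⟩
  rw [mul_comm (statWeight w k)]
  refine mul_le_mul_of_nonneg_right ?_ (statWeight_pos hw _).le
  rw [inv_mul_eq_div, le_div_iff₀ (by positivity), ← pow_add]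
  exact pow_le_pow_of_le_one hr0.le hr1.le (by omega)

lemma oddPow_reflect (t : ℝ) (x : ℤ) : oddPow t (-1 - x) = -oddPow t x := by
  simp [oddPow]

lemma oddPow_succ_sub {t : ℝ} (ht : 1 < t) (x : ℤ) :
    oddPow t (x + 1) - oddPow t x = (t - 1) * (t ^ x + t ^ (-2 - x)) := by
  have h0 : t ≠ 0 := by positivity
  have h1 : t ^ (x + 1) = t * t ^ x := by rw [zpow_add_one₀ h0, mul_comm]
  have h2 : t ^ (-1 - x) = t * t ^ (-2 - x) := by
    rw [show -1 - x = (-2 - x) + 1 by ring, zpow_add_one₀ h0, mul_comm]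
  have h3 : -1 - (x + 1) = -2 - x := by ring
  rw [oddPow, oddPow, h3, h1, h2]
  ring

lemma oddPow_natCast_nonneg {t : ℝ} (ht : 1 < t) (n : ℕ) : 0 ≤ oddPow t n :=
  sub_nonneg.2 (zpow_le_zpow_right₀ ht.le (by omega))

lemma oddPow_le {t : ℝ} (ht : 1 < t) (x : ℤ) : oddPow t x ≤ t ^ x :=
  sub_le_self _ (zpow_nonneg (by linarith) _)

/-- A nonnegative function whose increments are `-statWeight w * oddPow t`. -/
lemma exists_potential {w : ℤ → ℝ} (hw : GoodWeight w) :
    ∃ (t C : ℝ) (ψ : ℤ → ℝ), 1 < t ∧ 0 ≤ C ∧ (∀ x, 0 ≤ ψ x) ∧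
      (∀ x, ψ x = statWeight w x * oddPow t x + ψ (x + 1)) ∧
      (∀ n : ℕ, ψ n ≤ C * (statWeight w n * t ^ (n : ℤ))) ∧
      (∀ x, ψ (-x) = ψ x) ∧
      Summable fun n : ℕ => statWeight w n * t ^ (n : ℤ) := by
  obtain ⟨r, K, hr0, hr1, hK, hdec⟩ := statWeight_decay hw
  obtain ⟨t, ht, hrt⟩ : ∃ t : ℝ, 1 < t ∧ r * t < 1 := by
    refine ⟨(1 + r⁻¹) / 2, ?_, ?_⟩
    · have := (one_lt_inv₀ hr0).2 hr1
      linarith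
    · field_simp
      linarith
  have ht0 : 0 < t := by linarith
  have hgeo := summable_geometric_of_lt_one (by positivity : 0 ≤ r * t) hrt
  have hterm (n j : ℕ) : statWeight w (n + j : ℕ) * t ^ ((n + j : ℕ) : ℤ)
      ≤ K * (statWeight w n * t ^ (n : ℤ)) * (r * t) ^ j := by
    have := mul_le_mul_of_nonneg_right (hdec n j) (zpow_nonneg ht0.le ((n + j : ℕ) : ℤ))
    refine this.trans (le_of_eq ?_)
    rw [zpow_natCast, zpow_natCast, pow_add, mul_pow]
    ring
  have hnn (n : ℕ) : 0 ≤ statWeight w n * oddPow t n :=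
    mul_nonneg (statWeight_pos hw _).le (oddPow_natCast_nonneg ht n)
  have hle (n : ℕ) : statWeight w n * oddPow t n ≤ statWeight w n * t ^ (n : ℤ) :=
    mul_le_mul_of_nonneg_left (oddPow_le ht n) (statWeight_pos hw _).le
  have hsum (n : ℕ) : Summable fun j : ℕ => statWeight w (n + j : ℕ) * oddPow t (n + j : ℕ) :=
    Summable.of_nonneg_of_le (fun j => hnn _) (fun j => (hle _).trans (hterm n j))
      (hgeo.mul_left _)
  set f : ℕ → ℝ := fun n => ∑' j : ℕ, statWeight w (n + j : ℕ) * oddPow t (n + j : ℕ) with hf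
  have hfrec (n : ℕ) : f n = statWeight w n * oddPow t n + f (n + 1) := by
    simp only [hf]
    rw [(hsum n).tsum_eq_zero_add]
    simp only [add_zero]
    congr 1
    refine tsum_congr fun j => ?_
    rw [show n + (j + 1) = n + 1 + j by ring]
  refine ⟨t, K * (1 - r * t)⁻¹, fun x => f x.natAbs, ht, ?_, ?_, ?_, ?_, ?_, ?_⟩
  · exact mul_nonneg hK.le (inv_nonneg.2 (by linarith))
  · exact fun x => tsum_nonneg fun j => hnn _
  · intro x
    beta_reduce
    obtain ⟨n, rfl | rfl⟩ : ∃ n : ℕ, x = n ∨ x = -1 - n := by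
      rcases le_or_gt 0 x with h | h
      · exact ⟨x.toNat, by omega⟩
      · exact ⟨(-1 - x).toNat, by omega⟩
    · rw [Int.natAbs_natCast, hfrec n]
      congr 2
    · rw [statWeight_reflect, oddPow_reflect, show (-1 - (n : ℤ)).natAbs = n + 1 by omega,
        show (-1 - (n : ℤ) + 1).natAbs = n by omega, hfrec n]
      ring
  · intro n
    beta_reduce
    rw [Int.natAbs_natCast]
    refine ((hsum n).tsum_le_tsum (fun j => (hle _).trans (hterm n j))
      (hgeo.mul_left _)).trans (le_of_eq ?_)
    rw [tsum_mul_left, tsum_geometric_of_lt_one (by positivity) hrt]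
    ring
  · intro x
    simp
  · refine Summable.of_nonneg_of_le
      (fun n => mul_nonneg (statWeight_pos hw _).le (by positivity)) (fun n => ?_)
      (hgeo.mul_left (K * (statWeight w (0 : ℕ) * t ^ ((0 : ℕ) : ℤ))))
    simpa only [zero_add] using hterm 0 n

/-- A positive gradient weight `g` contracted by the action of the kernel on gradients. -/
lemma exists_contracted_gradient {w : ℤ → ℝ} (hw : GoodWeight w) :
    ∃ (t A α : ℝ) (g b : ℤ → ℝ), 1 < t ∧ 0 < A ∧ 0 < α ∧ α < 1 ∧ (∀ x, 0 ≤ b x) ∧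
      (∀ x, b x = pfun w x * (g (x - 1) + b (x + 1))) ∧
      (∀ x, qfun w x * (g (x - 1) + b (x + 1)) ≤ α * g x) ∧
      (∀ x, oddPow t (x + 1) - oddPow t x ≤ g x) ∧
      (∀ x, g x ≤ A * (oddPow t (x + 1) - oddPow t x)) ∧
      Summable fun n : ℕ => statWeight w n * t ^ (n : ℤ) := by
  obtain ⟨t, C, ψ, ht, hC, hψ0, hψ, hψC, hψe, hs⟩ := exists_potential hw
  have ht0 : 0 < t := by linarith
  set g : ℤ → ℝ := fun x => ψ (x + 1) / statWeight w x + oddPow t (x + 1) with hg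
  set b : ℤ → ℝ := fun x => ψ x / statWeight w (x - 1) with hb
  have hgb (x : ℤ) : g (x - 1) + b (x + 1)
      = ψ x / statWeight w (x - 1) + ψ x / statWeight w x := by
    have h1 := (statWeight_pos hw x).ne'
    have h2 := (statWeight_pos hw (x - 1)).ne'
    simp only [hg, hb, sub_add_cancel, add_sub_cancel_right]
    rw [hψ x]
    field_simp
    ring
  have hpq (x : ℤ) : pfun w x * (g (x - 1) + b (x + 1)) = b x := by
    have h1 := (statWeight_pos hw x).ne'
    have h2 := (statWeight_pos hw (x - 1)).ne'
    rw [hgb, hb]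
    have h3 := statWeight_flux hw x
    have h4 := pfun_add_qfun hw x
    field_simp
    linear_combination ψ x * h3 + ψ x * statWeight w x * h4
  have hq (x : ℤ) : qfun w x * (g (x - 1) + b (x + 1)) = ψ x / statWeight w x := by
    have h1 := (statWeight_pos hw x).ne'
    have h2 := (statWeight_pos hw (x - 1)).ne'
    rw [hgb]
    have h3 := statWeight_flux hw x
    have h4 := pfun_add_qfun hw x
    field_simp
    linear_combination -ψ x * h3 + ψ x * statWeight w (x - 1) * h4
  have hdiff (x : ℤ) : g x - ψ x / statWeight w x = oddPow t (x + 1) - oddPow t x := by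
    have h1 := (statWeight_pos hw x).ne'
    simp only [hg]
    rw [hψ x]
    field_simp
    ring
  have hup (x : ℤ) : g x ≤ (C + 1) * t * (t ^ x + t ^ (-2 - x)) := by
    obtain ⟨n, rfl | rfl⟩ : ∃ n : ℕ, x = n - 1 ∨ x = -1 - n := by
      rcases le_or_gt 0 x with h | h
      · exact ⟨(x + 1).toNat, by omega⟩
      · exact ⟨(-1 - x).toNat, by omega⟩
    · have h1 := statWeight_pos hw ((n : ℤ) - 1)
      have h2 : ψ n / statWeight w ((n : ℤ) - 1) ≤ C * t ^ (n : ℤ) := by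
        rw [div_le_iff₀ h1]
        refine (hψC n).trans ?_
        have := statWeight_antitone hw (Int.natCast_nonneg n)
        calc C * (statWeight w n * t ^ (n : ℤ))
            ≤ C * (statWeight w (n - 1) * t ^ (n : ℤ)) := by gcongr
          _ = _ := by ring
      have h3 := oddPow_le ht (n : ℤ)
      have h4 : t ^ (n : ℤ) = t * t ^ ((n : ℤ) - 1) := by
        rw [mul_comm, ← zpow_add_one₀ ht0.ne', sub_add_cancel]
      simp only [hg, sub_add_cancel]
      have h5 : 0 ≤ (C + 1) * t * t ^ (-2 - ((n : ℤ) - 1)) := by positivity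
      rw [h4] at h2 h3
      linarith
    · have h1 := statWeight_pos hw (n : ℤ)
      have h2 : ψ n / statWeight w n ≤ C * t ^ (n : ℤ) := by
        rw [div_le_iff₀ h1]
        refine (hψC n).trans (le_of_eq (by ring))
      have h3 := oddPow_le ht (-(n : ℤ))
      have h6 : t ^ (-(n : ℤ)) ≤ t ^ (n : ℤ) := zpow_le_zpow_right₀ ht.le (by omega)
      have h4 : t ^ (n : ℤ) = t * t ^ (-2 - (-1 - (n : ℤ))) := by
        rw [mul_comm, ← zpow_add_one₀ ht0.ne']
        congr 1
        ring
      simp only [hg]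
      rw [statWeight_reflect, show -1 - (n : ℤ) + 1 = -n by ring, hψe]
      have h5 : 0 ≤ (C + 1) * t * t ^ (-1 - (n : ℤ)) := by positivity
      rw [h4] at h2 h6
      linarith
  have ht1 : 0 < t - 1 := by linarith
  set A := (C + 1) * t / (t - 1) with hA
  have hA1 : 1 < A := by
    rw [hA, one_lt_div ht1]
    nlinarith [mul_nonneg hC ht0.le]
  have hup' (x : ℤ) : g x ≤ A * (oddPow t (x + 1) - oddPow t x) := by
    rw [oddPow_succ_sub ht, hA]
    refine (hup x).trans (le_of_eq ?_)
    field_simp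
  refine ⟨t, A, 1 - A⁻¹, g, b, ht, by linarith, ?_, ?_, ?_, ?_, ?_, ?_, hup', hs⟩
  · exact sub_pos.2 (inv_lt_one_of_one_lt₀ hA1)
  · exact sub_lt_self _ (by positivity)
  · exact fun x => div_nonneg (hψ0 x) (statWeight_pos hw _).le
  · exact fun x => (hpq x).symm
  · intro x
    rw [hq]
    have h1 := hup' x
    have h2 := hdiff x
    have h3 : A⁻¹ * g x ≤ oddPow t (x + 1) - oddPow t x := by
      rw [inv_mul_le_iff₀ (by linarith)]
      exact h1
    linarith
  · intro x
    rw [← hdiff]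
    exact sub_le_self _ (div_nonneg (hψ0 x) (statWeight_pos hw _).le)

lemma Pker_nonneg {w : ℤ → ℝ} (hw : GoodWeight w) (x y : ℤ) : 0 ≤ Pker w x y := by
  unfold Pker
  split_ifs
  · exact mul_nonneg (Finset.prod_nonneg fun _ _ => pfun_nonneg hw _) (qfun_nonneg hw _)
  · exact le_rfl

lemma Pker_rec (w : ℤ → ℝ) (x y : ℤ) :
    Pker w x y = (if y = x - 1 then qfun w x else 0) + pfun w x * Pker w (x + 1) y := by
  unfold Pker
  rcases lt_trichotomy y (x - 1) with h | rfl | h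
  · rw [if_neg (by omega), if_neg (by omega), if_neg (by omega)]
    simp
  · rw [if_pos le_rfl, if_pos rfl, if_neg (by omega)]
    simp
  · have : Finset.Icc x y = insert x (Finset.Icc (x + 1) y) := by
      ext z
      simp only [Finset.mem_Icc, Finset.mem_insert]
      omega
    rw [if_pos (by omega), if_neg (by omega), if_pos (by omega), this,
      Finset.prod_insert (by simp)]
    ring

lemma sum_Pker_le_one {w : ℤ → ℝ} (hw : GoodWeight w) (x : ℤ) (F : Finset ℤ) :
    ∑ y ∈ F, Pker w x y ≤ 1 := by
  have key (n : ℕ) : ∀ x : ℤ, (∀ y ∈ F, y < x - 1 + n) → ∑ y ∈ F, Pker w x y ≤ 1 := by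
    induction n with
    | zero =>
      intro x hF
      rw [Finset.sum_eq_zero fun y hy => ?_]
      · exact zero_le_one
      · have := hF y hy
        exact if_neg (by push_cast at this; omega)
    | succ n ih =>
      intro x hF
      have h1 := ih (x + 1) fun y hy => by
        have := hF y hy
        push_cast at this
        omega
      have h2 : ∑ y ∈ F, (if y = x - 1 then qfun w x else 0) ≤ qfun w x := by
        rw [Finset.sum_ite_eq']
        split_ifs
        · exact le_rfl
        · exact qfun_nonneg hw x
      rw [Finset.sum_congr rfl fun y _ => Pker_rec w x y, Finset.sum_add_distrib,
        ← Finset.mul_sum]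
      have h3 := mul_le_mul_of_nonneg_left h1 (pfun_nonneg hw x)
      have h4 := pfun_add_qfun hw x
      linarith
  obtain ⟨M, hM⟩ := F.bddAbove
  refine key (M - x + 2).toNat x fun y hy => ?_
  have := hM hy
  omega

lemma summable_Pker {w : ℤ → ℝ} (hw : GoodWeight w) (x : ℤ) : Summable (Pker w x) :=
  summable_of_sum_le (fun y => Pker_nonneg hw x y) (sum_Pker_le_one hw x)

lemma tsum_Pker_le_one {w : ℤ → ℝ} (hw : GoodWeight w) (x : ℤ) : ∑' y, Pker w x y ≤ 1 :=
  Real.tsum_le_of_sum_le (fun y => Pker_nonneg hw x y) (sum_Pker_le_one hw x)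

lemma Summable.mul_of_abs_le_one {ι : Type*} {f φ : ι → ℝ} (hf : Summable f) (hf0 : ∀ i, 0 ≤ f i)
    (hφ : ∀ i, |φ i| ≤ 1) : Summable fun i => f i * φ i :=
  Summable.of_norm_bounded hf fun i => by
    rw [Real.norm_eq_abs, abs_mul, abs_of_nonneg (hf0 i)]
    exact mul_le_of_le_one_right (hf0 i) (hφ i)

lemma abs_transOp_le_one {w : ℤ → ℝ} (hw : GoodWeight w) {φ : ℤ → ℝ} (hφ : ∀ y, |φ y| ≤ 1)
    (x : ℤ) : |transOp w φ x| ≤ 1 := by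
  have h : ∀ y, ‖Pker w x y * φ y‖ ≤ Pker w x y := fun y => by
    rw [Real.norm_eq_abs, abs_mul, abs_of_nonneg (Pker_nonneg hw x y)]
    exact mul_le_of_le_one_right (Pker_nonneg hw x y) (hφ y)
  exact (tsum_of_norm_bounded (summable_Pker hw x).hasSum h).trans (tsum_Pker_le_one hw x)

lemma transOp_rec {w : ℤ → ℝ} (hw : GoodWeight w) {φ : ℤ → ℝ} (hφ : ∀ y, |φ y| ≤ 1) (x : ℤ) :
    transOp w φ x = qfun w x * φ (x - 1) + pfun w x * transOp w φ (x + 1) := by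
  have h1 : HasSum (fun y => (if y = x - 1 then qfun w x else 0) * φ y)
      (qfun w x * φ (x - 1)) := by
    convert hasSum_ite_eq (x - 1) (qfun w x * φ (x - 1)) using 2 with y
    split_ifs with h
    · rw [h]
    · simp
  have h2 := ((summable_Pker hw (x + 1)).mul_of_abs_le_one (Pker_nonneg hw _) hφ).hasSum.mul_left
    (pfun w x)
  refine Eq.trans (tsum_congr fun y => ?_) (h1.add h2).tsum_eq
  rw [Pker_rec]
  ring

/-- Discrete maximum principle for bounded subsolutions of `v x ≤ pfun w x * v (x + 1)`. -/
lemma nonpos_of_le_pfun_mul {w : ℤ → ℝ} (hw : GoodWeight w) {v : ℤ → ℝ} {B : ℝ} (hB : ∀ x, v x ≤ B)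
    (hv : ∀ x, v x ≤ pfun w x * v (x + 1)) (x : ℤ) : v x ≤ 0 := by
  have hB' : ∀ x, v x ≤ |B| := fun x => (hB x).trans (le_abs_self B)
  have hdecay (n : ℕ) : ∀ x : ℤ, 0 ≤ x → v x ≤ |B| * (1 / 2) ^ n := by
    induction n with
    | zero => simpa using fun x _ => hB' x
    | succ n ih =>
      intro x hx
      have h1 := ih (x + 1) (by omega)
      calc v x ≤ pfun w x * v (x + 1) := hv x
        _ ≤ pfun w x * (|B| * (1 / 2) ^ n) := mul_le_mul_of_nonneg_left h1 (pfun_nonneg hw x)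
        _ ≤ 1 / 2 * (|B| * (1 / 2) ^ n) :=
          mul_le_mul_of_nonneg_right (pfun_le_half hw hx) (by positivity)
        _ = |B| * (1 / 2) ^ (n + 1) := by ring
  have hpos : ∀ x : ℤ, 0 ≤ x → v x ≤ 0 := fun x hx => by
    have h := (tendsto_pow_atTop_nhds_zero_of_lt_one (by norm_num : (0 : ℝ) ≤ 1 / 2)
      (by norm_num)).const_mul |B|
    rw [mul_zero] at h
    exact ge_of_tendsto' h fun n => hdecay n x hx
  rcases le_or_gt 0 x with hx | hx
  · exact hpos x hx
  · refine Int.leInductionDown (m := 0) (motive := fun n _ => v n ≤ 0) (hpos 0 le_rfl) ?_ x hx.le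
    intro n _ hn
    have := hv (n - 1)
    rw [sub_add_cancel] at this
    exact this.trans (mul_nonpos_of_nonneg_of_nonpos (pfun_nonneg hw _) hn)

lemma abs_transOp_sub_le {w : ℤ → ℝ} (hw : GoodWeight w) {α : ℝ} {g b : ℤ → ℝ}
    (hb0 : ∀ x, 0 ≤ b x) (hb : ∀ x, b x = pfun w x * (g (x - 1) + b (x + 1)))
    (hg : ∀ x, qfun w x * (g (x - 1) + b (x + 1)) ≤ α * g x)
    {φ : ℤ → ℝ} {L : ℝ} (hL : 0 ≤ L) (hφ : ∀ x, |φ x| ≤ 1)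
    (hφg : ∀ x, |φ (x + 1) - φ x| ≤ L * g x) (x : ℤ) :
    |transOp w φ (x + 1) - transOp w φ x| ≤ α * L * g x := by
  have hφg' (x : ℤ) : |φ x - φ (x - 1)| ≤ L * g (x - 1) := by
    simpa using hφg (x - 1)
  have htri (x : ℤ) : |transOp w φ (x + 1) - φ (x - 1)|
      ≤ |transOp w φ (x + 1) - φ x| + L * g (x - 1) :=
    (abs_sub_le _ (φ x) _).trans (by gcongr; exact hφg' x)
  have hbar (x : ℤ) : |transOp w φ x - φ (x - 1)| ≤ L * b x := by
    rw [← sub_nonpos]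
    refine nonpos_of_le_pfun_mul hw (v := fun x => |transOp w φ x - φ (x - 1)| - L * b x)
      (B := 2) (fun x => ?_) (fun x => ?_) x
    · have h1 := abs_transOp_le_one hw hφ x
      have h2 := hφ (x - 1)
      have h3 := abs_sub (transOp w φ x) (φ (x - 1))
      have h4 := mul_nonneg hL (hb0 x)
      linarith
    · have h1 : transOp w φ x - φ (x - 1) = pfun w x * (transOp w φ (x + 1) - φ (x - 1)) := by
        have h := transOp_rec hw hφ x
        have h' := pfun_add_qfun hw x
        linear_combination h + φ (x - 1) * h'
      rw [h1, abs_mul, abs_of_nonneg (pfun_nonneg hw x), hb x, add_sub_cancel_right]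
      have := mul_le_mul_of_nonneg_left (htri x) (pfun_nonneg hw x)
      linarith
  have h1 : transOp w φ (x + 1) - transOp w φ x
      = qfun w x * (transOp w φ (x + 1) - φ (x - 1)) := by
    have h := transOp_rec hw hφ x
    have h' := pfun_add_qfun hw x
    linear_combination -h - transOp w φ (x + 1) * h'
  have h2 := hbar (x + 1)
  rw [add_sub_cancel_right] at h2
  rw [h1, abs_mul, abs_of_nonneg (qfun_nonneg hw x)]
  calc qfun w x * |transOp w φ (x + 1) - φ (x - 1)|
      ≤ qfun w x * (L * (g (x - 1) + b (x + 1))) := by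
        refine mul_le_mul_of_nonneg_left ?_ (qfun_nonneg hw x)
        linarith [htri x]
    _ = L * (qfun w x * (g (x - 1) + b (x + 1))) := by ring
    _ ≤ L * (α * g x) := mul_le_mul_of_nonneg_left (hg x) hL
    _ = α * L * g x := by ring

lemma iterate_transOp_bounds {w : ℤ → ℝ} (hw : GoodWeight w) {α : ℝ} {g b : ℤ → ℝ} (hα : 0 ≤ α)
    (hb0 : ∀ x, 0 ≤ b x) (hb : ∀ x, b x = pfun w x * (g (x - 1) + b (x + 1)))
    (hg : ∀ x, qfun w x * (g (x - 1) + b (x + 1)) ≤ α * g x)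
    {φ : ℤ → ℝ} {L : ℝ} (hL : 0 ≤ L) (hφ : ∀ x, |φ x| ≤ 1)
    (hφg : ∀ x, |φ (x + 1) - φ x| ≤ L * g x) (m : ℕ) :
    (∀ x, |(transOp w)^[m] φ x| ≤ 1) ∧
      ∀ x, |(transOp w)^[m] φ (x + 1) - (transOp w)^[m] φ x| ≤ α ^ m * L * g x := by
  induction m with
  | zero => simpa using ⟨hφ, hφg⟩
  | succ m ih =>
    simp only [Function.iterate_succ_apply']
    refine ⟨abs_transOp_le_one hw ih.1, fun x => ?_⟩
    rw [pow_succ', mul_assoc α]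
    exact abs_transOp_sub_le hw hb0 hb hg (by positivity) ih.1 ih.2 x

lemma abs_sub_le_of_increments {φ S : ℤ → ℝ} (h : ∀ x, |φ (x + 1) - φ x| ≤ S (x + 1) - S x)
    (x : ℤ) : |φ 0 - φ x| ≤ |S 0 - S x| := by
  have h1 : Monotone fun x => S x - φ x := monotone_int_of_le_succ fun x => by
    linarith [le_abs_self (φ (x + 1) - φ x), h x]
  have h2 : Monotone fun x => S x + φ x := monotone_int_of_le_succ fun x => by
    linarith [neg_abs_le (φ (x + 1) - φ x), h x]
  rcases le_total 0 x with hx | hx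
  · have h3 := h1 hx
    have h4 := h2 hx
    beta_reduce at h3 h4
    rw [abs_sub_comm (S 0)]
    exact (abs_le.2 ⟨by linarith, by linarith⟩).trans (le_abs_self _)
  · have h3 := h1 hx
    have h4 := h2 hx
    beta_reduce at h3 h4
    exact (abs_le.2 ⟨by linarith, by linarith⟩).trans (le_abs_self _)

lemma hasSum_int_of_reflect {f : ℤ → ℝ} (hf : ∀ x, f (-1 - x) = f x)
    (hs : Summable fun n : ℕ => f n) : HasSum f (2 * ∑' n : ℕ, f n) := by
  rw [two_mul]
  refine HasSum.of_nat_of_neg_add_one hs.hasSum ?_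
  convert hs.hasSum using 2 with n
  rw [← hf]
  congr 1
  ring

lemma rho_eq (w : ℤ → ℝ) (x : ℤ) : rho w x = (Zconst w)⁻¹ * statWeight w x := rfl

lemma Zconst_eq (w : ℤ → ℝ) : Zconst w = 2 * ∑' n : ℕ, statWeight w n := by
  simp only [statWeight_natCast]
  rfl

lemma tsum_statWeight_transOp {w : ℤ → ℝ} (hw : GoodWeight w) (hs : Summable (statWeight w))
    {φ : ℤ → ℝ} (hφ : ∀ x, |φ x| ≤ 1) :
    ∑' x, statWeight w x * transOp w φ x = ∑' x, statWeight w x * φ x := by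
  have hT := abs_transOp_le_one hw hφ
  have h0 : ∀ x, 0 ≤ statWeight w x := fun x => (statWeight_pos hw x).le
  have hid (x : ℤ) : statWeight w (x - 1) * φ (x - 1)
      = statWeight w (x - 1) * transOp w φ x + statWeight w x * transOp w φ x
        - statWeight w x * transOp w φ (x + 1) := by
    have h1 := transOp_rec hw hφ x
    have h2 := pfun_add_qfun hw x
    have h3 := statWeight_flux hw x
    have hq : qfun w x ≠ 0 := (div_pos (hw.1 _) (add_pos (hw.1 _) (hw.1 _))).ne'
    apply mul_left_cancel₀ hq
    linear_combination -statWeight w (x - 1) * h1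
      + transOp w φ x * statWeight w (x - 1) * (-h2) + transOp w φ x * h3
      - transOp w φ (x + 1) * h3
  have e1 : Summable fun x => statWeight w (x - 1) * transOp w φ x :=
    ((Equiv.subRight (1 : ℤ)).summable_iff.2 hs).mul_of_abs_le_one (fun x => h0 _) hT
  have e2 : Summable fun x => statWeight w x * transOp w φ x := hs.mul_of_abs_le_one h0 hT
  have e3 : ∑' x, statWeight w (x - 1) * φ (x - 1) = ∑' x, statWeight w x * φ x :=
    (Equiv.subRight (1 : ℤ)).tsum_eq fun x => statWeight w x * φ x
  have e4 : ∑' x, statWeight w (x - 1) * transOp w φ x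
      = ∑' x, statWeight w x * transOp w φ (x + 1) := by
    rw [← (Equiv.subRight (1 : ℤ)).tsum_eq fun x => statWeight w x * transOp w φ (x + 1)]
    simp
  have e5 : Summable fun x => statWeight w x * transOp w φ (x + 1) :=
    hs.mul_of_abs_le_one h0 fun x => hT _
  rw [← e3, tsum_congr hid, (e1.add e2).tsum_sub e5, e1.tsum_add e2, e4]
  ring

lemma tsum_statWeight_iterate_transOp {w : ℤ → ℝ} (hw : GoodWeight w)
    (hs : Summable (statWeight w)) (m : ℕ) {φ : ℤ → ℝ} (hφ : ∀ x, |φ x| ≤ 1) :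
    ∑' x, statWeight w x * (transOp w)^[m] φ x = ∑' x, statWeight w x * φ x := by
  induction m generalizing φ with
  | zero => rfl
  | succ m ih =>
    rw [Function.iterate_succ_apply, ih (abs_transOp_le_one hw hφ),
      tsum_statWeight_transOp hw hs hφ]

lemma summable_mul_substochastic {a : ℤ → ℝ} {K : ℤ → ℤ → ℝ} (ha0 : ∀ z, 0 ≤ a z)
    (ha : Summable a) (hK0 : ∀ z y, 0 ≤ K z y) (hK : ∀ z, Summable (K z))
    (hK1 : ∀ z, ∑' y, K z y ≤ 1) : Summable fun z : ℤ × ℤ => a z.1 * K z.1 z.2 := by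
  have hnn : 0 ≤ fun z : ℤ × ℤ => a z.1 * K z.1 z.2 := fun z => mul_nonneg (ha0 _) (hK0 _ _)
  have h1 (z : ℤ) : Summable fun y => a z * K z y := (hK z).mul_left (a z)
  have h2 : Summable fun z => ∑' y, a z * K z y := by
    refine Summable.of_nonneg_of_le
      (fun z => tsum_nonneg fun y => mul_nonneg (ha0 z) (hK0 z y)) (fun z => ?_) ha
    rw [tsum_mul_left]
    exact mul_le_of_le_one_right (ha0 z) (hK1 z)
  exact (summable_prod_of_nonneg hnn).2 ⟨h1, h2⟩

lemma Pm_properties {w : ℤ → ℝ} (hw : GoodWeight w) (m : ℕ) (x : ℤ) :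
    (∀ y, 0 ≤ Pm w m x y) ∧ Summable (Pm w m x) ∧
      ∀ φ : ℤ → ℝ, (∀ y, |φ y| ≤ 1) →
        ∑' y, Pm w m x y * φ y = (transOp w)^[m] φ x := by
  induction m with
  | zero =>
    refine ⟨fun y => ?_, ?_, fun φ _ => ?_⟩
    · simp only [Pm]
      split_ifs <;> norm_num
    · exact summable_of_ne_finset_zero (s := {x}) fun y hy => by
        simp only [Finset.mem_singleton] at hy
        simp [Pm, Ne.symm hy]
    · simp [Pm]
  | succ m ih =>
    obtain ⟨h0, hs, hT⟩ := ih
    have hF0 (z y : ℤ) : 0 ≤ Pm w m x z * Pker w z y := mul_nonneg (h0 z) (Pker_nonneg hw z y)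
    have hF : Summable fun z : ℤ × ℤ => Pm w m x z.1 * Pker w z.1 z.2 :=
      summable_mul_substochastic h0 hs (Pker_nonneg hw) (summable_Pker hw) (tsum_Pker_le_one hw)
    refine ⟨fun y => tsum_nonneg fun z => hF0 z y,
      hF.prod_symm.prod, fun φ hφ => ?_⟩
    have hFφ : Summable fun z : ℤ × ℤ => Pm w m x z.1 * Pker w z.1 z.2 * φ z.2 :=
      hF.mul_of_abs_le_one (fun z => hF0 z.1 z.2) fun z => hφ z.2
    calc ∑' y, Pm w (m + 1) x y * φ y
        = ∑' y, ∑' z, Pm w m x z * Pker w z y * φ y := by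
          simp only [Pm, tsum_mul_right]
      _ = ∑' z, ∑' y, Pm w m x z * Pker w z y * φ y :=
          Summable.tsum_comm (f := fun z y => Pm w m x z * Pker w z y * φ y) hFφ
      _ = ∑' z, Pm w m x z * transOp w φ z := by
          simp only [mul_assoc, tsum_mul_left, transOp]
      _ = (transOp w)^[m + 1] φ x := by
          rw [hT _ (abs_transOp_le_one hw hφ), Function.iterate_succ_apply]

lemma sub_one_div_le_oddPow_succ_sub {t : ℝ} (ht : 1 < t) (x : ℤ) :
    (t - 1) / t ≤ oddPow t (x + 1) - oddPow t x := by
  have ht0 : 0 < t := by linarith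
  rw [oddPow_succ_sub ht, div_eq_mul_inv]
  refine mul_le_mul_of_nonneg_left ?_ (by linarith)
  rw [← zpow_neg_one]
  rcases le_total (-1) x with h | h
  · exact (zpow_le_zpow_right₀ ht.le h).trans (le_add_of_nonneg_right (by positivity))
  · exact (zpow_le_zpow_right₀ ht.le (by omega)).trans (le_add_of_nonneg_left (by positivity))

/-- Iterates of the kernel at `0` approach the
stationary mean exponentially fast, uniformly over functions bounded by one. -/
lemma exists_uniform_convergence {w : ℤ → ℝ} (hw : GoodWeight w) :
    Summable (statWeight w) ∧ ∃ D α : ℝ, 0 < α ∧ α < 1 ∧ ∀ (m : ℕ) (φ : ℤ → ℝ),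
      (∀ x, |φ x| ≤ 1) → (transOp w)^[m] φ 0 - ∑' x, rho w x * φ x ≤ D * α ^ m := by
  obtain ⟨t, A, α, g, b, ht, hA, hα0, hα1, hb0, hb, hg, hgl, hgu, hst⟩ :=
    exists_contracted_gradient hw
  have ht0 : 0 < t := by linarith
  have h0 : ∀ x, 0 ≤ statWeight w x := fun x => (statWeight_pos hw x).le
  have hsN : Summable fun n : ℕ => statWeight w n :=
    Summable.of_nonneg_of_le (fun n => h0 _) (fun n => le_mul_of_one_le_right (h0 _)
      (one_le_zpow₀ ht.le (by omega))) hst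
  have hsum := hasSum_int_of_reflect (statWeight_reflect w) hsN
  rw [← Zconst_eq] at hsum
  have hs := hsum.summable
  have hZ : 0 < Zconst w := by
    rw [← hsum.tsum_eq]
    exact hs.tsum_pos h0 0 (statWeight_pos hw 0)
  have hodd : Summable fun x => statWeight w x * |oddPow t 0 - oddPow t x| := by
    have h1 : Summable fun x => statWeight w x * |oddPow t x| := by
      refine (hasSum_int_of_reflect (fun x => ?_) ?_).summable
      · rw [statWeight_reflect, oddPow_reflect, abs_neg]
      · refine Summable.of_nonneg_of_le (fun n => mul_nonneg (h0 _) (abs_nonneg _)) (fun n => ?_) hst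
        rw [abs_of_nonneg (oddPow_natCast_nonneg ht n)]
        exact mul_le_mul_of_nonneg_left (oddPow_le ht n) (h0 _)
    refine Summable.of_nonneg_of_le (fun x => mul_nonneg (h0 _) (abs_nonneg _)) (fun x => ?_)
      ((hs.mul_right |oddPow t 0|).add h1)
    rw [← mul_add]
    exact mul_le_mul_of_nonneg_left (abs_sub _ _) (h0 _)
  refine ⟨hs, (Zconst w)⁻¹ * (2 * t / (t - 1) * A *
    ∑' x, statWeight w x * |oddPow t 0 - oddPow t x|), α, hα0, hα1, fun m φ hφ => ?_⟩
  set L := 2 * t / (t - 1) with hLdef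
  have ht1 : 0 < t - 1 := by linarith
  have hL : 0 < L := by positivity
  have hφg (x : ℤ) : |φ (x + 1) - φ x| ≤ L * g x := by
    have h1 : |φ (x + 1) - φ x| ≤ 2 := by
      have h2 := abs_sub (φ (x + 1)) (φ x)
      linarith [hφ x, hφ (x + 1)]
    refine h1.trans ?_
    calc (2 : ℝ) = L * ((t - 1) / t) := by
          rw [hLdef]
          field_simp
      _ ≤ L * g x := by
          gcongr
          exact (sub_one_div_le_oddPow_succ_sub ht x).trans (hgl x)
  obtain ⟨hm1, hm2⟩ := iterate_transOp_bounds hw hα0.le hb0 hb hg hL.le hφ hφg m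
  set f := (transOp w)^[m] φ with hf
  have hinc (x : ℤ) : |f 0 - f x| ≤ α ^ m * L * A * |oddPow t 0 - oddPow t x| := by
    have h1 := abs_sub_le_of_increments (φ := f) (S := fun x => α ^ m * L * A * oddPow t x)
      (fun x => ?_) x
    · rwa [← mul_sub, abs_mul (α ^ m * L * A),
        abs_of_nonneg (by positivity : 0 ≤ α ^ m * L * A)] at h1
    · refine (hm2 x).trans ?_
      have := mul_le_mul_of_nonneg_left (hgu x) (by positivity : 0 ≤ α ^ m * L)
      linarith
  have hmean : ∑' x, rho w x * φ x = (Zconst w)⁻¹ * ∑' x, statWeight w x * f x := by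
    rw [hf, tsum_statWeight_iterate_transOp hw hs m hφ, ← tsum_mul_left]
    simp only [rho_eq, mul_assoc]
  have hconst : f 0 = (Zconst w)⁻¹ * ∑' x, statWeight w x * f 0 := by
    rw [tsum_mul_right, hsum.tsum_eq]
    field_simp
  rw [hmean]
  nth_rewrite 1 [hconst]
  rw [← mul_sub, ← (hs.mul_right (f 0)).tsum_sub (hs.mul_of_abs_le_one h0 hm1), mul_assoc]
  refine mul_le_mul_of_nonneg_left ?_ (inv_nonneg.2 hZ.le)
  calc ∑' x, (statWeight w x * f 0 - statWeight w x * f x)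
      ≤ ∑' x, α ^ m * L * A * (statWeight w x * |oddPow t 0 - oddPow t x|) := by
        refine Summable.tsum_le_tsum (fun x => ?_)
          ((hs.mul_right (f 0)).sub (hs.mul_of_abs_le_one h0 hm1)) (hodd.mul_left _)
        have := mul_le_mul_of_nonneg_left ((le_abs_self _).trans (hinc x)) (h0 x)
        linarith
    _ = L * A * (∑' x, statWeight w x * |oddPow t 0 - oddPow t x|) * α ^ m := by
        rw [tsum_mul_left]
        ring

/-- exponentially fast convergence to stationarity in total variation. -/
theorem stmt_3 (w : ℤ → ℝ) (hw : GoodWeight w) :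
    ∃ C : ℝ, ∃ β > (0 : ℝ), ∀ m : ℕ,
      ∑' y : ℤ, |Pm w m 0 y - rho w y| < C * Real.exp (-β * m) := by
  obtain ⟨hs, D, α, hα0, hα1, hD⟩ := exists_uniform_convergence hw
  refine ⟨D + 1, -Real.log α, neg_pos.2 (Real.log_neg hα0 hα1), fun m => ?_⟩
  have hexp : Real.exp (-(-Real.log α) * m) = α ^ m := by
    rw [neg_neg, mul_comm, Real.exp_nat_mul, Real.exp_log hα0]
  rw [hexp]
  set φ : ℤ → ℝ := fun y => (SignType.sign (Pm w m 0 y - rho w y) : ℝ) with hφdef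
  have hφ (y : ℤ) : |φ y| ≤ 1 := by
    rcases lt_trichotomy (Pm w m 0 y - rho w y) 0 with h | h | h <;> simp [hφdef, h]
  obtain ⟨hP0, hPs, hPT⟩ := Pm_properties hw m 0
  have hρs : Summable (rho w) := hs.mul_left _
  have hρ0 (y : ℤ) : 0 ≤ rho w y := by
    rw [rho_eq, Zconst_eq]
    have := statWeight_pos hw y
    have : 0 ≤ ∑' n : ℕ, statWeight w n := tsum_nonneg fun n => (statWeight_pos hw _).le
    positivity
  calc ∑' y : ℤ, |Pm w m 0 y - rho w y|
      = ∑' y : ℤ, (Pm w m 0 y * φ y - rho w y * φ y) := by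
        refine tsum_congr fun y => ?_
        rw [← sub_mul, self_mul_sign]
    _ = (transOp w)^[m] φ 0 - ∑' y, rho w y * φ y := by
        rw [(hPs.mul_of_abs_le_one hP0 hφ).tsum_sub (hρs.mul_of_abs_le_one hρ0 hφ), hPT φ hφ]
    _ ≤ D * α ^ m := hD m φ hφ
    _ < (D + 1) * α ^ m := by
        gcongr
        exact lt_add_one D
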